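/- For every real z ≠ 0 and all integers ℓ ≥ p ≥ 0: Σ_{k=p}^{ℓ} (2k+1)(k−p+1)_{2p}[j_k(z)]² = z²·A·[j_ℓ(z)]² + z²·B·[j_{ℓ+1}(z)]² + z·C·j_ℓ(z)·j_{ℓ+1}(z) + (p!/(3/2)_p)·z^{2p}, where A = −(1/2)·Σ_{k=0}^{p} (p−k+1)_k·(ℓ−p+k+2)_{2p−2k}/(p−k+1/2)_{k+1} · z^{2k}, B = −(1/2)·Σ_{k=0}^{p} (p−k+1)_k·(ℓ−p+k+1)_{2p−2k}/(p−k+1/2)_{k+1} · z^{2k}, and C = Σ_{k=0}^{p} (p−k+1)_k·(ℓ−p+k+1)_{2p−2k+1}/(p−k+1/2)_{k+1} · z^{2k}. -/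

import Mathlib

open Finset

/-- Auxiliary: `sphjAux z n` is the spherical Bessel function `j_{n-1}(z)`. -/
noncomputable def sphjAux (z : ℝ) : ℕ → ℝ
  | 0 => Real.cos z / z
  | 1 => Real.sin z / z
  | (n + 2) => ((2 * (n : ℝ) + 1) / z) * sphjAux z (n + 1) - sphjAux z n

/-- The spherical Bessel function `j_k(z)` for integer `k ≥ -1`. -/
noncomputable def sphj (k : ℤ) (z : ℝ) : ℝ := sphjAux z (k + 1).toNat

/-- The Pochhammer symbol `(f)_n = f (f+1) ⋯ (f+n-1)`, with `(f)_0 = 1`. -/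
noncomputable def poch (f : ℝ) (n : ℕ) : ℝ := ∏ i ∈ Finset.range n, (f + (i : ℝ))

/-- Coefficient `A_ℓ^{[2],(p)}(z)` of the second hierarchy. -/
noncomputable def A2 (p ℓ : ℕ) (z : ℝ) : ℝ :=
  -(1 / 2) * ∑ k ∈ Finset.range (p + 1),
    poch ((p : ℝ) - k + 1) k * poch ((ℓ : ℝ) - p + k + 2) (2 * p - 2 * k) /
      poch ((p : ℝ) - k + 1 / 2) (k + 1) * z ^ (2 * k)

/-- Coefficient `B_ℓ^{[2],(p)}(z)` of the second hierarchy. -/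
noncomputable def B2 (p ℓ : ℕ) (z : ℝ) : ℝ :=
  -(1 / 2) * ∑ k ∈ Finset.range (p + 1),
    poch ((p : ℝ) - k + 1) k * poch ((ℓ : ℝ) - p + k + 1) (2 * p - 2 * k) /
      poch ((p : ℝ) - k + 1 / 2) (k + 1) * z ^ (2 * k)

/-- Coefficient `C_ℓ^{[2],(p)}(z)` of the second hierarchy. -/
noncomputable def C2 (p ℓ : ℕ) (z : ℝ) : ℝ :=
  ∑ k ∈ Finset.range (p + 1),
    poch ((p : ℝ) - k + 1) k * poch ((ℓ : ℝ) - p + k + 1) (2 * p - 2 * k + 1) /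
      poch ((p : ℝ) - k + 1 / 2) (k + 1) * z ^ (2 * k)

lemma poch_succ (f : ℝ) (n : ℕ) : poch f (n + 1) = poch f n * (f + n) := by
  simp [poch, Finset.prod_range_succ]

lemma poch_succ' (f : ℝ) (n : ℕ) : poch f (n + 1) = f * poch (f + 1) n := by
  simp only [poch, Finset.prod_range_succ']
  rw [mul_comm]
  congr 1
  · simp
  · apply Finset.prod_congr rfl
    intro i _
    push_cast
    ring

lemma poch_zero_of (f : ℝ) (n i : ℕ) (hi : i < n) (h : f + i = 0) : poch f n = 0 :=
  Finset.prod_eq_zero (Finset.mem_range.2 hi) h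

lemma poch_pos (f : ℝ) (hf : 0 < f) (n : ℕ) : 0 < poch f n :=
  Finset.prod_pos fun i _ => by positivity

/-- central Pochhammer product -/
noncomputable def cp (m : ℕ) (y : ℝ) : ℝ := poch (y + 1 - m) (2 * m)

/-- coefficient -/
noncomputable def cc (p k : ℕ) : ℝ :=
  poch ((p : ℝ) - k + 1) k / poch ((p : ℝ) - k + 1 / 2) (k + 1)

lemma cp_diff (m : ℕ) (x : ℝ) :
    cp (m + 1) (x + 2) - cp (m + 1) x = 2 * (m + 1) * (2 * x + 3) * cp m (x + 1) := by
  unfold cp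
  have e : 2 * (m + 1) = 2 * m + 1 + 1 := by ring
  rw [e]
  have h1 : x + 2 + 1 - ((m + 1 : ℕ) : ℝ) = x + 1 + 1 - m := by push_cast; ring
  have h2 : x + 1 - ((m + 1 : ℕ) : ℝ) + 1 + 1 = x + 1 + 1 - m := by push_cast; ring
  have h3 : poch (x + 2 + 1 - ((m + 1 : ℕ) : ℝ)) (2 * m + 1 + 1)
      = poch (x + 1 + 1 - m) (2 * m) * (x + 1 + 1 - m + (2 * m : ℕ))
        * (x + 1 + 1 - m + (2 * m + 1 : ℕ)) := by
    rw [h1, poch_succ, poch_succ]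
  have h4 : poch (x + 1 - ((m + 1 : ℕ) : ℝ)) (2 * m + 1 + 1)
      = (x - m) * ((x - m + 1) * poch (x + 1 + 1 - m) (2 * m)) := by
    rw [poch_succ', poch_succ', h2]; push_cast; ring
  rw [h3, h4]
  push_cast
  ring

lemma q_right (m : ℕ) (y : ℝ) : poch (y + 1 - m) (2 * m + 1) = cp m y * (y + 1 + m) := by
  rw [poch_succ, cp]; push_cast; ring

lemma q_left (m : ℕ) (y : ℝ) : poch (y + 1 - m) (2 * m + 1) = (y + 1 - m) * cp m (y + 1) := by
  rw [poch_succ', cp]; congr 2; ring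

lemma cc_succ (m k : ℕ) :
    cc (m + 1 + k) (k + 1) * (m + 1 / 2) = cc (m + 1 + k) k * (m + 1) := by
  unfold cc
  have h1 : ((m + 1 + k : ℕ) : ℝ) - (k + 1 : ℕ) = m := by push_cast; ring
  have h2 : ((m + 1 + k : ℕ) : ℝ) - k = m + 1 := by push_cast; ring
  rw [h1, h2, poch_succ' _ k, poch_succ' ((m : ℝ) + 1 / 2) (k + 1)]
  have h3 : (m : ℝ) + 1 / 2 + 1 = m + 1 + 1 / 2 := by ring
  rw [h3]
  have := (poch_pos ((m : ℝ) + 1 + 1 / 2) (by positivity) (k + 1)).ne'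
  have h4 : (m : ℝ) + 1 / 2 ≠ 0 := by positivity
  field_simp

noncomputable def GA (p : ℕ) (x z : ℝ) : ℝ :=
  ∑ k ∈ range (p + 1), cc p k * cp (p - k) x * z ^ (2 * k)

noncomputable def GC (p : ℕ) (x z : ℝ) : ℝ :=
  ∑ k ∈ range (p + 1), cc p k * (cp (p - k) x * (x + 1 + (p - k : ℕ))) * z ^ (2 * k)

lemma GC_add (p : ℕ) (x z : ℝ) : GC p (x + 1) z + GC p x z = (2 * x + 3) * GA p (x + 1) z := by
  unfold GC GA
  rw [← Finset.sum_add_distrib, Finset.mul_sum]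
  apply Finset.sum_congr rfl
  intro k _
  rw [← q_right (p - k) x, q_left]
  ring

lemma cc_zero (p : ℕ) : cc p 0 * (p + 1 / 2) = 1 := by
  have : (p : ℝ) + 1 / 2 ≠ 0 := by positivity
  simp [cc, poch] at *
  field_simp

lemma G_tel (p : ℕ) (x z : ℝ) :
    -(1 / 2) * (z ^ 2 * GA p (x + 2) z) - (2 * x + 3) ^ 2 / 2 * GA p (x + 1) z
      + (2 * x + 3) * GC p (x + 1) z + 1 / 2 * (z ^ 2 * GA p x z)
      = (2 * x + 3) * cp p (x + 1) := by
  let W : ℕ → ℝ := fun k =>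
    cc p k * (2 * x + 3) * cp (p - k) (x + 1) * ((p : ℝ) - k + 1 / 2) * z ^ (2 * k)
  have hW0 : W 0 = (2 * x + 3) * cp p (x + 1) := by
    have := cc_zero p
    simp only [W, Nat.sub_zero, Nat.cast_zero, sub_zero, mul_zero, pow_zero]
    linear_combination (2 * x + 3) * cp p (x + 1) * this
  have hWp : W (p + 1) = 0 := by
    have : cc p (p + 1) = 0 := by
      rw [cc, poch_zero_of _ (p + 1) 0 (by omega) (by push_cast; ring), zero_div]
    simp [W, this]
  rw [← hW0, ← sub_zero (W 0), ← hWp, ← Finset.sum_range_sub']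
  unfold GA GC
  simp only [Finset.mul_sum]
  rw [← Finset.sum_sub_distrib, ← Finset.sum_add_distrib, ← Finset.sum_add_distrib]
  apply Finset.sum_congr rfl
  intro k hk
  have hk' : k ≤ p := by simpa [Nat.lt_succ_iff] using hk
  rcases hk'.eq_or_lt with rfl | hlt
  · rw [hWp]
    simp only [W, Nat.sub_self, cp, poch]
    simp
    ring
  · obtain ⟨m, rfl⟩ : ∃ m, p = m + 1 + k := ⟨p - k - 1, by omega⟩
    have e1 : m + 1 + k - k = m + 1 := by omega
    have e2 : m + 1 + k - (k + 1) = m := by omega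
    simp only [W, e1, e2]
    have h1 := cp_diff m x
    have h2 := cc_succ m k
    push_cast
    have h3 : z ^ (2 * (k + 1)) = z ^ 2 * z ^ (2 * k) := by ring
    rw [h3]
    linear_combination (-(1/2) * z ^ 2 * cc (m + 1 + k) k * z ^ (2 * k)) * h1
      + (2 * x + 3) * cp m (x + 1) * z ^ 2 * z ^ (2 * k) * h2

noncomputable def GG (p : ℕ) (z x u v : ℝ) : ℝ :=
  z ^ 2 * (-(1 / 2) * GA p (x + 1) z) * u ^ 2 + z ^ 2 * (-(1 / 2) * GA p x z) * v ^ 2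
    + z * GC p x z * u * v

lemma GG_step (p : ℕ) (z x u v w : ℝ) (h : z * w = (2 * x + 3) * v - z * u) :
    GG p z (x + 1) v w - GG p z x u v = (2 * x + 3) * cp p (x + 1) * v ^ 2 := by
  have h1 := GC_add p x z
  have h2 := G_tel p x z
  have e : x + 1 + 1 = x + 2 := by ring
  unfold GG
  rw [e]
  have h3 : z ^ 2 * w ^ 2 = ((2 * x + 3) * v - z * u) ^ 2 := by rw [← h]; ring
  linear_combination (-(1 / 2) * GA p (x + 1) z) * h3 + GC p (x + 1) z * v * h
    - z * u * v * h1 + v ^ 2 * h2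

lemma GG_base (p : ℕ) (z : ℝ) (hz : z ≠ 0) :
    GG p z (-1) (Real.cos z / z) (Real.sin z / z)
      + (p.factorial : ℝ) / poch (3 / 2) p * z ^ (2 * p) = 0 := by
  have hcp : ∀ m : ℕ, 0 < m → cp m 0 = 0 ∧ cp m (-1) = 0 := by
    intro m hm
    constructor
    · refine poch_zero_of _ _ (m - 1) (by omega) ?_
      rw [Nat.cast_sub (by omega)]; push_cast; ring
    · exact poch_zero_of _ _ m (by omega) (by ring)
  have hc0 : ∀ y, cp 0 y = 1 := by intro y; simp [cp, poch]
  have hf : ∀ p : ℕ, poch 1 p = p.factorial := by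
    intro p
    induction p with
    | zero => simp [poch]
    | succ n ih => rw [poch_succ, ih, Nat.factorial_succ]; push_cast; ring
  have hcc : cc p p = 2 * (p.factorial / poch (3 / 2) p) := by
    rw [cc, sub_self, zero_add, zero_add, hf, poch_succ']
    norm_num
    have := (poch_pos (3 / 2) (by norm_num) p).ne'
    field_simp
  have hA : ∀ y, (y = 0 ∨ y = -1) → GA p y z = cc p p * z ^ (2 * p) := by
    intro y hy
    unfold GA
    rw [Finset.sum_range_succ, Finset.sum_eq_zero, Nat.sub_self, hc0]
    · ring
    · intro k hk
      have := hcp (p - k) (by have := Finset.mem_range.1 hk; omega)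
      rcases hy with rfl | rfl
      · rw [this.1]; ring
      · rw [this.2]; ring
  have hC : GC p (-1) z = 0 := by
    unfold GC
    apply Finset.sum_eq_zero
    intro k hk
    rcases Nat.eq_zero_or_pos (p - k) with h | h
    · rw [h]; simp
    · rw [(hcp _ h).2]; ring
  unfold GG
  rw [hC, hA (-1) (Or.inr rfl), hA (-1 + 1) (Or.inl (by norm_num)), hcc]
  have := Real.sin_sq_add_cos_sq z
  have h1 : z ^ 2 * (Real.cos z / z) ^ 2 = Real.cos z ^ 2 := by field_simp
  have h2 : z ^ 2 * (Real.sin z / z) ^ 2 = Real.sin z ^ 2 := by field_simp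
  generalize (p.factorial : ℝ) / poch (3 / 2) p = q
  linear_combination (-q * z ^ (2 * p)) * (this + h1 + h2)

lemma sum_aux (p : ℕ) (z : ℝ) (hz : z ≠ 0) (n : ℕ) :
    ∑ k ∈ range n, (2 * (k : ℝ) + 1) * cp p k * (sphjAux z (k + 1)) ^ 2
      = GG p z ((n : ℝ) - 1) (sphjAux z n) (sphjAux z (n + 1))
        + (p.factorial : ℝ) / poch (3 / 2) p * z ^ (2 * p) := by
  induction n with
  | zero =>
    have := GG_base p z hz
    simp only [Finset.range_zero, Finset.sum_empty, Nat.cast_zero, zero_sub, zero_add, sphjAux]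
    exact this.symm
  | succ n ih =>
    rw [Finset.sum_range_succ, ih]
    have h := GG_step p z ((n : ℝ) - 1) (sphjAux z n) (sphjAux z (n + 1)) (sphjAux z (n + 2))
      (by rw [sphjAux]; field_simp; ring)
    have e : (n : ℝ) - 1 + 1 = n := by ring
    rw [e] at h
    have e2 : ((n + 1 : ℕ) : ℝ) - 1 = n := by push_cast; ring
    rw [e2]
    linear_combination -h

/-- The second hierarchy of sum rules. -/
theorem second_hierarchy_sum_rule (z : ℝ) (hz : z ≠ 0) (p ℓ : ℕ) (hpℓ : p ≤ ℓ) :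
    ∑ k ∈ Finset.Icc p ℓ,
        (2 * (k : ℝ) + 1) * poch ((k : ℝ) - p + 1) (2 * p) * (sphj k z) ^ 2 =
      z ^ 2 * A2 p ℓ z * (sphj ℓ z) ^ 2 + z ^ 2 * B2 p ℓ z * (sphj (ℓ + 1) z) ^ 2 +
        z * C2 p ℓ z * sphj ℓ z * sphj (ℓ + 1) z +
        (p.factorial : ℝ) / poch (3 / 2) p * z ^ (2 * p) := by
  have hj : ∀ k : ℕ, sphj k z = sphjAux z (k + 1) := by
    intro k; unfold sphj; congr 1
  have hj' : sphj ((ℓ : ℤ) + 1) z = sphjAux z (ℓ + 1 + 1) := by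
    have := hj (ℓ + 1)
    push_cast at this
    exact this
  have hA : A2 p ℓ z = -(1 / 2) * GA p ((ℓ : ℝ) + 1) z := by
    unfold A2 GA
    congr 1
    apply Finset.sum_congr rfl
    intro k hk
    have hk' : k ≤ p := by simpa [Nat.lt_succ_iff] using hk
    rw [cc, cp, Nat.cast_sub hk', Nat.mul_sub]
    rw [show (ℓ : ℝ) + 1 + 1 - ((p : ℝ) - k) = (ℓ : ℝ) - p + k + 2 by ring]
    ring
  have hB : B2 p ℓ z = -(1 / 2) * GA p (ℓ : ℝ) z := by
    unfold B2 GA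
    congr 1
    apply Finset.sum_congr rfl
    intro k hk
    have hk' : k ≤ p := by simpa [Nat.lt_succ_iff] using hk
    rw [cc, cp, Nat.cast_sub hk', Nat.mul_sub]
    rw [show (ℓ : ℝ) + 1 - ((p : ℝ) - k) = (ℓ : ℝ) - p + k + 1 by ring]
    ring
  have hC : C2 p ℓ z = GC p (ℓ : ℝ) z := by
    unfold C2 GC
    apply Finset.sum_congr rfl
    intro k hk
    have hk' : k ≤ p := by simpa [Nat.lt_succ_iff] using hk
    rw [← q_right, cc, Nat.cast_sub hk', Nat.mul_sub]
    rw [show (ℓ : ℝ) + 1 - ((p : ℝ) - k) = (ℓ : ℝ) - p + k + 1 by ring]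
    ring
  have hmain := sum_aux p z hz (ℓ + 1)
  have e2 : ((ℓ + 1 : ℕ) : ℝ) - 1 = ℓ := by push_cast; ring
  rw [e2, GG] at hmain
  rw [hA, hB, hC, hj, hj', ← hmain]
  have hsub : Finset.Icc p ℓ ⊆ range (ℓ + 1) := by
    intro k hk
    simp only [Finset.mem_Icc, Finset.mem_range] at *
    omega
  rw [← Finset.sum_subset hsub]
  · apply Finset.sum_congr rfl
    intro k _
    rw [hj, cp, show (k : ℝ) + 1 - p = (k : ℝ) - p + 1 by ring]
  · intro k hk hk2
    simp only [Finset.mem_Icc, Finset.mem_range] at *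
    have hlt : k < p := by omega
    have : cp p k = 0 := by
      refine poch_zero_of _ _ (p - 1 - k) (by omega) ?_
      rw [Nat.cast_sub (by omega), Nat.cast_sub (by omega)]
      push_cast; ring
    rw [this]; ring
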